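/- arXiv:1306.6593 — 6 statements merged into one kernel-verified Lean document; each statement's English description precedes it below -/
import Mathlib

section
/- Let H be a finite connected simple graph, let r be a natural number, and let D be a nonempty finite set of vertices of H such that every vertex of H is at (unweighted shortest-path) distance at most r from some vertex of D. Then the diameter of H is at most (2r+1)·|D| − 1; that is, for all vertices u, v of H, dist_H(u,v) ≤ (2r+1)·|D| − 1. -/
theorem SimpleGraph.Connected.exists_dist_eq_of_le_dist {V : Type*} {G : SimpleGraph V}
    (hG : G.Connected) {u v : V} {i : ℕ} (hi : i ≤ G.dist u v) : ∃ w, G.dist u w = i := by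
  obtain ⟨p, hp⟩ := hG.exists_walk_length_eq_dist u v
  refine ⟨p.getVert i, ?_⟩
  have htake := G.dist_le (p.take i)
  have hdrop := G.dist_le (p.drop i)
  have htri := hG.dist_triangle (u := u) (v := p.getVert i) (w := v)
  rw [SimpleGraph.Walk.take_length] at htake
  rw [SimpleGraph.Walk.drop_length] at hdrop
  omega

/-- If `H` is a finite connected simple graph, `r : ℕ`, and `D` is a
nonempty finite set of vertices such that every vertex is within (shortest-path)
distance `r` of some vertex of `D`, then the diameter of `H` is at most
`(2r+1)·|D| − 1`. -/
theorem diameter_le_of_distance_cover {V : Type*} [Fintype V] (H : SimpleGraph V)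
    (hconn : H.Connected) (r : ℕ) (D : Finset V) (hD : D.Nonempty)
    (hcov : ∀ v : V, ∃ d ∈ D, H.dist v d ≤ r) :
    ∀ u v : V, H.dist u v ≤ (2 * r + 1) * D.card - 1 := by
  intro u v
  have hsub : Finset.range (H.dist u v + 1) ⊆
      D.biUnion fun d => Finset.Icc (H.dist u d - r) (H.dist u d + r) := by
    intro i hi
    obtain ⟨w, rfl⟩ := hconn.exists_dist_eq_of_le_dist (Finset.mem_range_succ_iff.mp hi)
    obtain ⟨d, hd, hwd⟩ := hcov w
    have hud := hconn.dist_triangle (u := u) (v := w) (w := d)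
    have huw := hconn.dist_triangle (u := u) (v := d) (w := w)
    rw [H.dist_comm (u := d)] at huw
    exact Finset.mem_biUnion.mpr ⟨d, hd, Finset.mem_Icc.mpr ⟨by omega, by omega⟩⟩
  have hcard := (Finset.card_le_card hsub).trans
    (Finset.card_biUnion_le_card_mul D _ (2 * r + 1) fun d _ => by
      rw [Nat.card_Icc]
      omega)
  rw [Finset.card_range, mul_comm] at hcard
  omega
end

section
/- Let G be a finite simple graph and S ⊆ V(G) a set of terminals such that for every terminal t ∈ S, the set δ(t) of edges incident to t is a minimum (t, S∖{t})-cut, i.e., every (t, S∖{t})-cut F satisfies |F| ≥ |δ(t)|. Then the set ⋃_{t∈S} δ(t) is an edge multiway cut for (G,S), and moreover |⋃_{t∈S} δ(t)| ≤ 2·|X| for every edge multiway cut X for (G,S); in particular, ⋃_{t∈S} δ(t) is a 2-approximate edge multiway cut. -/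
/-- `X` is an `(A,B)`-cut in `G`: a set of edges of `G` whose deletion leaves no
connected component containing both a vertex of `A` and a vertex of `B`. -/
def IsCut {V : Type*} (G : SimpleGraph V) (A B : Set V) (X : Set (Sym2 V)) : Prop :=
  X ⊆ G.edgeSet ∧ ∀ a ∈ A, ∀ b ∈ B, ¬ (G.deleteEdges X).Reachable a b

/-- `X` is an edge multiway cut for terminal set `S` in `G`: a set of edges of `G`
whose deletion leaves no two distinct terminals in the same connected component. -/
def IsMultiwayCut {V : Type*} (G : SimpleGraph V) (S : Set V) (X : Set (Sym2 V)) : Prop :=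
  X ⊆ G.edgeSet ∧ ∀ s ∈ S, ∀ t ∈ S, s ≠ t → ¬ (G.deleteEdges X).Reachable s t

/-- Deleting the edges incident to the terminals isolates every terminal. -/
theorem isMultiwayCut_iUnion_incidenceSet {V : Type*} (G : SimpleGraph V) (S : Set V) :
    IsMultiwayCut G S (⋃ t ∈ S, G.incidenceSet t) := by
  refine ⟨Set.iUnion₂_subset fun t _ => G.incidenceSet_subset t, ?_⟩
  rintro s hs t - hne ⟨p⟩
  cases p with
  | nil => exact hne rfl
  | cons h _ =>
    rw [SimpleGraph.deleteEdges_adj] at h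
    exact h.2 (Set.mem_biUnion hs ⟨h.1, Sym2.mem_mk_left _ _⟩)

/-- The edges of `X` with an endpoint in the connected component of `t` in `G - X`. -/
def componentEdges {V : Type*} (G : SimpleGraph V) (X : Set (Sym2 V)) (t : V) :
    Set (Sym2 V) :=
  {e ∈ X | ∃ v ∈ e, (G.deleteEdges X).Reachable t v}

theorem reachable_deleteEdges_of_componentEdges {V : Type*} {G : SimpleGraph V}
    {X : Set (Sym2 V)} {t u : V}
    (h : (G.deleteEdges (componentEdges G X t)).Reachable t u) :
    (G.deleteEdges X).Reachable t u := by
  rw [SimpleGraph.reachable_iff_reflTransGen] at h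
  induction h with
  | refl => exact .refl _
  | @tail v w _ hvw ih =>
    rw [SimpleGraph.deleteEdges_adj] at hvw
    have hX : s(v, w) ∉ X := fun hX => hvw.2 ⟨hX, v, Sym2.mem_mk_left _ _, ih⟩
    exact ih.trans (SimpleGraph.deleteEdges_adj.2 ⟨hvw.1, hX⟩).reachable

theorem IsMultiwayCut.isCut_componentEdges {V : Type*} {G : SimpleGraph V} {S : Set V}
    {X : Set (Sym2 V)} (hX : IsMultiwayCut G S X) {t : V} (ht : t ∈ S) :
    IsCut G {t} (S \ {t}) (componentEdges G X t) := by
  refine ⟨fun e he => hX.1 he.1, ?_⟩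
  rintro a rfl b ⟨hb, hne⟩ h
  exact hX.2 a ht b hb (Ne.symm hne) (reachable_deleteEdges_of_componentEdges h)

/-- Every edge has an endpoint in the components of at most two terminals. -/
theorem IsMultiwayCut.ncard_setOf_mem_componentEdges_le {V : Type*} {G : SimpleGraph V}
    {S : Set V} {X : Set (Sym2 V)} (hX : IsMultiwayCut G S X) (e : Sym2 V) :
    {t ∈ S | e ∈ componentEdges G X t}.ncard ≤ 2 := by
  induction e with
  | _ a b =>
    have hone (v : V) : {t ∈ S | (G.deleteEdges X).Reachable t v}.Subsingleton := by
      rintro s ⟨hs, hsv⟩ t ⟨ht, htv⟩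
      by_contra hne
      exact hX.2 s hs t ht hne (hsv.trans htv.symm)
    have hsub : {t ∈ S | s(a, b) ∈ componentEdges G X t} ⊆
        {t ∈ S | (G.deleteEdges X).Reachable t a} ∪
          {t ∈ S | (G.deleteEdges X).Reachable t b} := by
      rintro t ⟨ht, -, v, hv, htv⟩
      rcases Sym2.mem_iff.1 hv with rfl | rfl
      exacts [.inl ⟨ht, htv⟩, .inr ⟨ht, htv⟩]
    have hcard (v : V) := (Set.ncard_le_one (hone v).finite).2 fun _ hs _ ht => hone v hs ht
    have h := (Set.ncard_le_ncard hsub ((hone a).finite.union (hone b).finite)).trans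
      (Set.ncard_union_le _ _)
    linarith [hcard a, hcard b]

theorem IsMultiwayCut.sum_ncard_componentEdges_le {V : Type*} [Finite V] {G : SimpleGraph V}
    {S : Finset V} {X : Set (Sym2 V)} (hX : IsMultiwayCut G S X) :
    ∑ t ∈ S, (componentEdges G X t).ncard ≤ 2 * X.ncard := by
  classical
  have hfin := X.toFinite
  have h₁ (t : V) : (componentEdges G X t).ncard =
      (hfin.toFinset.bipartiteAbove (fun t e => e ∈ componentEdges G X t) t).card := by
    rw [← Set.ncard_coe_finset]
    congr 1
    ext e
    simpa [Finset.bipartiteAbove] using fun he : e ∈ componentEdges G X t => he.1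
  have h₂ (e : Sym2 V) :
      (S.bipartiteBelow (fun t e => e ∈ componentEdges G X t) e).card ≤ 2 := by
    rw [← Set.ncard_coe_finset]
    simpa [Finset.bipartiteBelow] using hX.ncard_setOf_mem_componentEdges_le e
  simp_rw [h₁]
  rw [Finset.sum_card_bipartiteAbove_eq_sum_card_bipartiteBelow,
    Set.ncard_eq_toFinset_card X hfin, mul_comm]
  exact Finset.sum_le_card_nsmul _ _ _ fun e _ => h₂ e

/-- If for every terminal `t ∈ S` the set `δ(t)` of edges incident
to `t` is a minimum `(t, S∖{t})`-cut, then `⋃_{t∈S} δ(t)` is an edge multiway cut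
for `(G,S)` whose size is at most twice that of any edge multiway cut for `(G,S)`. -/
theorem isolating_cuts_two_approx {V : Type*} [Fintype V] (G : SimpleGraph V) (S : Set V)
    (hmin : ∀ t ∈ S, ∀ F : Set (Sym2 V), IsCut G {t} (S \ {t}) F →
      (G.incidenceSet t).ncard ≤ F.ncard) :
    IsMultiwayCut G S (⋃ t ∈ S, G.incidenceSet t) ∧
      ∀ X : Set (Sym2 V), IsMultiwayCut G S X →
        (⋃ t ∈ S, G.incidenceSet t).ncard ≤ 2 * X.ncard := by
  classical
  refine ⟨isMultiwayCut_iUnion_incidenceSet G S, fun X hX => ?_⟩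
  lift S to Finset V using S.toFinite
  calc (⋃ t ∈ (S : Set V), G.incidenceSet t).ncard
      ≤ ∑ t ∈ S, (G.incidenceSet t).ncard := S.set_ncard_biUnion_le _
    _ ≤ ∑ t ∈ S, (componentEdges G X t).ncard :=
      Finset.sum_le_sum fun t ht => hmin t ht _ (hX.isCut_componentEdges ht)
    _ ≤ 2 * X.ncard := hX.sum_ncard_componentEdges_le
end

section
/- Let G be a finite simple graph, S ⊆ V(G) a set of terminals, and t ∈ S. Let K_t be a minimum (t, S∖{t})-cut furthest from t, i.e., a minimum (t, S∖{t})-cut such that reach(t,K') ⊆ reach(t,K_t) for every minimum (t, S∖{t})-cut K'. Then there exists an edge multiway cut X for (G,S) of minimum cardinality such that no edge of X has both of its endpoints in reach(t, K_t). -/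
/-- `X` is a minimum `(A,B)`-cut: an `(A,B)`-cut of smallest possible cardinality. -/
def IsMinCut {V : Type*} (G : SimpleGraph V) (A B : Set V) (X : Set (Sym2 V)) : Prop :=
  IsCut G A B X ∧ ∀ Y : Set (Sym2 V), IsCut G A B Y → X.ncard ≤ Y.ncard

/-- `reach G A X` is the set of vertices lying in a connected component of `G − X`
containing a vertex of `A`. -/
def reach {V : Type*} (G : SimpleGraph V) (A : Set V) (X : Set (Sym2 V)) : Set V :=
  {v | ∃ a ∈ A, (G.deleteEdges X).Reachable a v}

/-- The edges of `G` with exactly one endpoint in `A`. -/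
def cutEdges {V : Type*} (G : SimpleGraph V) (A : Set V) : Set (Sym2 V) :=
  {e | e ∈ G.edgeSet ∧ (∃ v ∈ e, v ∈ A) ∧ ∃ v ∈ e, v ∉ A}

lemma mk_mem_cutEdges {V : Type*} {G : SimpleGraph V} {A : Set V} {u v : V}
    (h : G.Adj u v) (hu : u ∈ A) (hv : v ∉ A) : s(u, v) ∈ cutEdges G A :=
  ⟨h, ⟨u, by simp, hu⟩, v, by simp, hv⟩

lemma SimpleGraph.Reachable.mem_of_adj_closed {V : Type*} {H : SimpleGraph V} {A : Set V}
    (hA : ∀ u v, H.Adj u v → u ∈ A → v ∈ A) {u v : V} (h : H.Reachable u v) (hu : u ∈ A) :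
    v ∈ A := by
  obtain ⟨p⟩ := h
  induction p with
  | nil => exact hu
  | cons hadj _ ih => exact ih (hA _ _ hadj hu)

/-- Submodularity of the cut function of a finite graph. -/
lemma ncard_cutEdges_union_add_inter_le {V : Type*} [Finite V] (G : SimpleGraph V)
    (A B : Set V) :
    (cutEdges G (A ∪ B)).ncard + (cutEdges G (A ∩ B)).ncard ≤
      (cutEdges G A).ncard + (cutEdges G B).ncard := by
  rw [← Set.ncard_union_add_ncard_inter (cutEdges G (A ∪ B)) (cutEdges G (A ∩ B)),
    ← Set.ncard_union_add_ncard_inter (cutEdges G A) (cutEdges G B)]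
  refine add_le_add (Set.ncard_le_ncard ?_) (Set.ncard_le_ncard ?_)
  all_goals
    intro e
    induction e with | _ x y
    simp only [cutEdges, Set.mem_union, Set.mem_inter_iff, Set.mem_ofPred_eq, Sym2.mem_iff,
      exists_eq_or_imp, exists_eq_left]
    tauto

lemma isCut_cutEdges {V : Type*} {G : SimpleGraph V} {A B P : Set V}
    (hA : A ⊆ P) (hB : Disjoint P B) : IsCut G A B (cutEdges G P) := by
  refine ⟨fun e he => he.1, fun a ha b hb hr => ?_⟩
  refine Set.disjoint_left.mp hB (hr.mem_of_adj_closed (A := P) ?_ (hA ha)) hb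
  intro u v huv hu
  by_contra hv
  rw [SimpleGraph.deleteEdges_adj] at huv
  exact huv.2 (mk_mem_cutEdges huv.1 hu hv)

lemma subset_reach {V : Type*} (G : SimpleGraph V) (A : Set V) (X : Set (Sym2 V)) :
    A ⊆ reach G A X :=
  fun a ha => ⟨a, ha, .refl a⟩

lemma cutEdges_reach_subset {V : Type*} (G : SimpleGraph V) (A : Set V) (X : Set (Sym2 V)) :
    cutEdges G (reach G A X) ⊆ X := by
  rintro e ⟨he, ⟨u, hue, a, ha, hau⟩, v, hve, hv⟩
  by_contra heX
  have huv : u ≠ v := by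
    rintro rfl
    exact hv ⟨a, ha, hau⟩
  obtain rfl := (Sym2.mem_and_mem_iff huv).mp ⟨hue, hve⟩
  exact hv ⟨a, ha, hau.trans
    (SimpleGraph.Adj.reachable (SimpleGraph.deleteEdges_adj.mpr ⟨he, heX⟩))⟩

lemma IsCut.disjoint_reach {V : Type*} {G : SimpleGraph V} {A B : Set V} {X : Set (Sym2 V)}
    (h : IsCut G A B X) : Disjoint (reach G A X) B :=
  Set.disjoint_left.mpr fun v ⟨a, ha, hav⟩ hv => h.2 a ha v hv hav

lemma IsMultiwayCut.isCut {V : Type*} {G : SimpleGraph V} {S : Set V} {X : Set (Sym2 V)}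
    (h : IsMultiwayCut G S X) {t : V} (ht : t ∈ S) : IsCut G {t} (S \ {t}) X := by
  refine ⟨h.1, ?_⟩
  rintro a rfl b ⟨hb, hba⟩
  exact h.2 a ht b hb fun hab => hba hab.symm

lemma isMultiwayCut_edgeSet {V : Type*} (G : SimpleGraph V) (S : Set V) :
    IsMultiwayCut G S G.edgeSet := by
  refine ⟨subset_rfl, fun s _ t _ hst h => hst ?_⟩
  refine (h.mem_of_adj_closed (A := {s}) ?_ rfl).symm
  intro u v huv
  rw [SimpleGraph.deleteEdges_adj] at huv
  exact absurd huv.1 huv.2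

/-- Replacing the edges of a multiway cut that meet `P` by the boundary of `P` gives a multiway
cut again, if `t` is the only terminal in `P`. -/
lemma IsMultiwayCut.cutEdges_union {V : Type*} {G : SimpleGraph V} {S P : Set V}
    {X : Set (Sym2 V)} (h : IsMultiwayCut G S X) {t : V} (htP : t ∈ P)
    (hP : Disjoint P (S \ {t})) :
    IsMultiwayCut G S (cutEdges G P ∪ {e ∈ X | ∀ v ∈ e, v ∉ P}) := by
  have hclosed : ∀ u v, (G.deleteEdges (cutEdges G P ∪ {e ∈ X | ∀ v ∈ e, v ∉ P})).Adj u v →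
      u ∉ P → v ∉ P ∧ (G.deleteEdges X).Adj u v := by
    intro u v huv hu
    rw [SimpleGraph.deleteEdges_adj] at huv
    have hv : v ∉ P := fun hv =>
      huv.2 (Or.inl (Sym2.eq_swap ▸ mk_mem_cutEdges huv.1.symm hv hu))
    refine ⟨hv, SimpleGraph.deleteEdges_adj.mpr ⟨huv.1, fun hX => huv.2 (Or.inr ⟨hX, ?_⟩)⟩⟩
    intro w hw
    rcases Sym2.mem_iff.mp hw with rfl | rfl <;> assumption
  have houtside : ∀ s ∈ S, s ≠ t → s ∉ P := fun s hs hst hsP =>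
    Set.disjoint_left.mp hP hsP ⟨hs, hst⟩
  have hreach : ∀ s ∈ S, s ≠ t → ∀ w,
      (G.deleteEdges (cutEdges G P ∪ {e ∈ X | ∀ v ∈ e, v ∉ P})).Reachable s w →
      w ∉ P ∧ (G.deleteEdges X).Reachable s w := fun s hs hst w hw =>
    hw.mem_of_adj_closed (A := {w | w ∉ P ∧ (G.deleteEdges X).Reachable s w})
      (fun u v huv hu => ⟨(hclosed u v huv hu.1).1,
        hu.2.trans (hclosed u v huv hu.1).2.reachable⟩) ⟨houtside s hs hst, .refl s⟩
  refine ⟨Set.union_subset (fun e he => he.1) (fun e he => h.1 he.1), ?_⟩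
  intro a ha b hb hab hr
  by_cases hat : a = t
  · subst hat
    exact (hreach b hb hab.symm a hr.symm).1 htP
  · exact h.2 a ha b hb hab (hreach a ha hat b hr).2

/-- Let `K` be a minimum `(t, S∖{t})`-cut furthest from `t`.
Then some minimum edge multiway cut for `(G,S)` contains no edge with both
endpoints in `reach(t, K)`. -/
theorem exists_minMultiwayCut_avoiding_furthest_cut_side {V : Type*} [Fintype V]
    (G : SimpleGraph V) (S : Set V) (t : V) (ht : t ∈ S) (K : Set (Sym2 V))
    (hK : IsMinCut G {t} (S \ {t}) K)
    (hfar : ∀ K' : Set (Sym2 V), IsMinCut G {t} (S \ {t}) K' →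
      reach G {t} K' ⊆ reach G {t} K) :
    ∃ X : Set (Sym2 V), IsMultiwayCut G S X ∧
      (∀ Y : Set (Sym2 V), IsMultiwayCut G S Y → X.ncard ≤ Y.ncard) ∧
      ∀ e ∈ X, ¬ (∀ v ∈ e, v ∈ reach G {t} K) := by
  obtain ⟨X, hX, hmin⟩ := Set.exists_min_image {X | IsMultiwayCut G S X} Set.ncard
    (Set.toFinite _) ⟨_, isMultiwayCut_edgeSet G S⟩
  set R := reach G {t} K
  set A := reach G {t} X
  have htR : {t} ⊆ R := subset_reach G {t} K
  have htA : {t} ⊆ A := subset_reach G {t} X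
  have hR : Disjoint R (S \ {t}) := hK.1.disjoint_reach
  have hA : Disjoint A (S \ {t}) := (IsMultiwayCut.isCut hX ht).disjoint_reach
  have hRK : (cutEdges G R).ncard ≤ K.ncard :=
    Set.ncard_le_ncard (cutEdges_reach_subset G {t} K)
  have hinter : K.ncard ≤ (cutEdges G (A ∩ R)).ncard :=
    hK.2 _ (isCut_cutEdges (Set.subset_inter htA htR) (hA.mono_left Set.inter_subset_left))
  have hsub := ncard_cutEdges_union_add_inter_le G A R
  have hsplit : (cutEdges G A).ncard + {e ∈ X | ∀ v ∈ e, v ∉ A ∪ R}.ncard ≤ X.ncard := by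
    rw [← Set.ncard_union_eq]
    · exact Set.ncard_le_ncard
        (Set.union_subset (cutEdges_reach_subset G {t} X) (Set.sep_subset _ _))
    · rw [Set.disjoint_left]
      rintro e ⟨-, ⟨v, hve, hv⟩, -⟩ he
      exact he.2 v hve (Or.inl hv)
  have hunion := Set.ncard_union_le (cutEdges G (A ∪ R)) {e ∈ X | ∀ v ∈ e, v ∉ A ∪ R}
  refine ⟨_, IsMultiwayCut.cutEdges_union hX (Or.inl (htA rfl))
      (Set.disjoint_union_left.mpr ⟨hA, hR⟩),
    fun Y hY => le_trans (by omega) (hmin Y hY), ?_⟩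
  rintro e (⟨-, -, v, hve, hv⟩ | ⟨-, he⟩) heR
  · exact hv (Or.inr (heR v hve))
  · exact he _ e.out_fst_mem (Or.inr (heR _ e.out_fst_mem))
end

section
/- There exists a universal constant c > 0 such that the following holds. Let ε ∈ (0,1/2), let G be a finite connected edge-weighted graph, and let N and S be two paths in G with common endpoints l and r, such that S is a shortest l–r path in G (its weight equals dist_G(l,r)) and every proper subpath of N (every subpath of N other than N itself) is ε-short in G. Then there exists a subgraph H of G containing N ∪ S such that w(H) ≤ c·ε^{−4}·(w(N)+w(S)), and for every pair of vertices s, t ∈ V(N) ∪ V(S) there is a walk from s to t in H of weight at most (1+ε)·dist_G(s,t). (This is the single-pair strip sparsification theorem: a strip is a brick whose perimeter decomposes into the north boundary N and the south boundary S with exactly these metric properties, and the construction and its correctness use only these properties.) -/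
/-- The weight of a walk: the sum of the weights of its edges. -/
def walkWeight {V : Type*} {G : SimpleGraph V} (w : Sym2 V → ℝ) {u v : V}
    (p : G.Walk u v) : ℝ :=
  (p.edges.map w).sum

/-- The weighted distance between two vertices: the infimum (= minimum, in a finite
connected graph with positive weights) of the weights of walks between them. -/
noncomputable def wdist {V : Type*} (G : SimpleGraph V) (w : Sym2 V → ℝ) (u v : V) : ℝ :=
  sInf {x : ℝ | ∃ p : G.Walk u v, walkWeight w p = x}

/-- The weight of the initial segment of the walk `p` up to (the first occurrence of)
the vertex `x`.  For a simple path `P`, the distance along `P` between vertices `x`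
and `y` of `P` is `|prefixWeight P x − prefixWeight P y|`. -/
noncomputable def prefixWeight {V : Type*} [DecidableEq V] {G : SimpleGraph V}
    (w : Sym2 V → ℝ) {a b : V} (p : G.Walk a b) (x : V) (hx : x ∈ p.support) : ℝ :=
  walkWeight w (p.takeUntil x hx)

/-- The total weight of a set of edges. -/
noncomputable def setWeight {V : Type*} (w : Sym2 V → ℝ) (H : Set (Sym2 V)) : ℝ :=
  ∑ᶠ e ∈ H, w e

section Walks

variable {V : Type*} {G : SimpleGraph V} {w : Sym2 V → ℝ}

@[simp] lemma walkWeight_nil {u : V} : walkWeight w (SimpleGraph.Walk.nil : G.Walk u u) = 0 := by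
  simp [walkWeight]

@[simp] lemma walkWeight_cons {u v x : V} (h : G.Adj u v) (p : G.Walk v x) :
    walkWeight w (SimpleGraph.Walk.cons h p) = w s(u, v) + walkWeight w p := by
  simp [walkWeight]

lemma walkWeight_append {u v x : V} (p : G.Walk u v) (q : G.Walk v x) :
    walkWeight w (p.append q) = walkWeight w p + walkWeight w q := by
  simp [walkWeight]

lemma walkWeight_reverse {u v : V} (p : G.Walk u v) :
    walkWeight w p.reverse = walkWeight w p := by
  simp [walkWeight, List.sum_reverse]

lemma walkWeight_nonneg (hw : ∀ e ∈ G.edgeSet, 0 < w e) {u v : V} (p : G.Walk u v) :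
    0 ≤ walkWeight w p := by
  refine List.sum_nonneg fun x hx => ?_
  obtain ⟨e, he, rfl⟩ := List.mem_map.1 hx
  exact (hw e (p.edges_subset_edgeSet he)).le

lemma walkWeight_bypass_le [DecidableEq V] (hw : ∀ e ∈ G.edgeSet, 0 < w e) {u v : V}
    (p : G.Walk u v) : walkWeight w p.bypass ≤ walkWeight w p := by
  induction p with
  | nil => simp [SimpleGraph.Walk.bypass]
  | @cons a b c h p ih =>
    have h0 := hw _ ((SimpleGraph.mem_edgeSet G).2 h)
    simp only [SimpleGraph.Walk.bypass]
    split_ifs with hs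
    · have h1 : walkWeight w (p.bypass.takeUntil a hs) + walkWeight w (p.bypass.dropUntil a hs)
          = walkWeight w p.bypass := by
        rw [← walkWeight_append, SimpleGraph.Walk.take_spec]
      have h2 := walkWeight_nonneg hw (p.bypass.takeUntil a hs)
      rw [walkWeight_cons]
      linarith
    · simpa using ih

lemma wdist_le (hw : ∀ e ∈ G.edgeSet, 0 < w e) {u v : V} (p : G.Walk u v) :
    wdist G w u v ≤ walkWeight w p := by
  refine csInf_le ⟨0, ?_⟩ ⟨p, rfl⟩
  rintro x ⟨q, rfl⟩
  exact walkWeight_nonneg hw q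

lemma exists_walkWeight_eq_wdist [Finite V] (hw : ∀ e ∈ G.edgeSet, 0 < w e) (hG : G.Connected)
    (u v : V) : ∃ p : G.Walk u v, walkWeight w p = wdist G w u v := by
  classical
  have := Fintype.ofFinite V
  have : Nonempty (G.Path u v) := ⟨(hG.preconnected u v).some.toPath⟩
  obtain ⟨p, hp⟩ := Finite.exists_min fun p : G.Path u v => walkWeight w p.1
  refine ⟨p.1, le_antisymm (le_csInf ⟨_, p.1, rfl⟩ ?_) (wdist_le hw _)⟩
  rintro x ⟨q, rfl⟩
  exact (hp q.toPath).trans (walkWeight_bypass_le hw q)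

lemma wdist_nonneg (hw : ∀ e ∈ G.edgeSet, 0 < w e) (u v : V) : 0 ≤ wdist G w u v := by
  refine Real.sInf_nonneg ?_
  rintro x ⟨q, rfl⟩
  exact walkWeight_nonneg hw q

lemma wdist_comm (u v : V) : wdist G w u v = wdist G w v u := by
  unfold wdist
  congr 1
  ext x
  constructor <;> rintro ⟨q, rfl⟩ <;> exact ⟨q.reverse, walkWeight_reverse q⟩

lemma wdist_triangle [Finite V] (hw : ∀ e ∈ G.edgeSet, 0 < w e) (hG : G.Connected)
    (u v x : V) : wdist G w u x ≤ wdist G w u v + wdist G w v x := by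
  obtain ⟨p, hp⟩ := exists_walkWeight_eq_wdist hw hG u v
  obtain ⟨q, hq⟩ := exists_walkWeight_eq_wdist hw hG v x
  rw [← hp, ← hq, ← walkWeight_append]
  exact wdist_le hw _

variable [DecidableEq V]

lemma prefixWeight_nonneg (hw : ∀ e ∈ G.edgeSet, 0 < w e) {a b : V} (p : G.Walk a b) {x : V}
    (hx : x ∈ p.support) : 0 ≤ prefixWeight w p x hx :=
  walkWeight_nonneg hw _

lemma prefixWeight_add_dropUntil {a b : V} (p : G.Walk a b) {x : V} (hx : x ∈ p.support) :
    prefixWeight w p x hx + walkWeight w (p.dropUntil x hx) = walkWeight w p := by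
  rw [prefixWeight, ← walkWeight_append, SimpleGraph.Walk.take_spec]

lemma prefixWeight_start {a b : V} (p : G.Walk a b) (h : a ∈ p.support) :
    prefixWeight w p a h = 0 := by
  cases p <;> simp [prefixWeight, SimpleGraph.Walk.takeUntil]

/-- Any two vertices of a walk are joined along it by a walk whose weight is the difference of
their positions. -/
lemma exists_walk_along (hw : ∀ e ∈ G.edgeSet, 0 < w e) {a b : V} (p : G.Walk a b) {x y : V}
    (hx : x ∈ p.support) (hy : y ∈ p.support) :
    ∃ q : G.Walk x y, (∀ e ∈ q.edges, e ∈ p.edges) ∧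
      walkWeight w q = |prefixWeight w p x hx - prefixWeight w p y hy| := by
  induction p with
  | nil =>
    obtain rfl := SimpleGraph.Walk.mem_support_nil_iff.1 hx
    obtain rfl := SimpleGraph.Walk.mem_support_nil_iff.1 hy
    exact ⟨SimpleGraph.Walk.nil, by simp⟩
  | @cons a c b h p ih =>
    by_cases hxa : x = a
    · subst hxa
      refine ⟨(SimpleGraph.Walk.cons h p).takeUntil y hy,
        fun e he => SimpleGraph.Walk.edges_takeUntil_subset_edges _ hy he, ?_⟩
      rw [prefixWeight_start, zero_sub, abs_neg, abs_of_nonneg (prefixWeight_nonneg hw _ hy)]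
      rfl
    by_cases hya : y = a
    · subst hya
      refine ⟨((SimpleGraph.Walk.cons h p).takeUntil x hx).reverse, fun e he =>
        SimpleGraph.Walk.edges_takeUntil_subset_edges _ hx (by simpa using he), ?_⟩
      rw [prefixWeight_start, sub_zero, abs_of_nonneg (prefixWeight_nonneg hw _ hx),
        walkWeight_reverse]
      rfl
    have hx' : x ∈ p.support := by simpa [hxa] using hx
    have hy' : y ∈ p.support := by simpa [hya] using hy
    have key : ∀ (z : V) (hz : z ∈ (SimpleGraph.Walk.cons h p).support) (hz' : z ∈ p.support),
        z ≠ a → prefixWeight w (SimpleGraph.Walk.cons h p) z hz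
          = w s(a, c) + prefixWeight w p z hz' := by
      intro z hz hz' hza
      simp only [prefixWeight]
      rw [SimpleGraph.Walk.takeUntil_cons hz' hza.symm, walkWeight_cons]
    obtain ⟨q, hq, hqw⟩ := ih hx' hy'
    refine ⟨q, fun e he => by simp [hq e he], ?_⟩
    rw [hqw, key x hx hx' hxa, key y hy hy' hya]
    congr 1
    ring

/-- Along a shortest walk, positions realise distances. -/
lemma abs_prefixWeight_sub_le_wdist [Finite V] (hw : ∀ e ∈ G.edgeSet, 0 < w e)
    (hG : G.Connected) {a b : V} (p : G.Walk a b) (hp : walkWeight w p = wdist G w a b) {x y : V}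
    (hx : x ∈ p.support) (hy : y ∈ p.support) :
    |prefixWeight w p x hx - prefixWeight w p y hy| ≤ wdist G w x y := by
  have key : ∀ {x y : V} (hx : x ∈ p.support) (hy : y ∈ p.support),
      prefixWeight w p y hy - prefixWeight w p x hx ≤ wdist G w x y := by
    intro x y hx hy
    have h1 : wdist G w a x ≤ prefixWeight w p x hx := wdist_le hw _
    have h2 := wdist_le hw (p.dropUntil y hy)
    have h3 := prefixWeight_add_dropUntil (w := w) p hy
    have h4 := wdist_triangle hw hG a x b
    have h5 := wdist_triangle hw hG x y b
    linarith
  rw [abs_le]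
  constructor
  · linarith [key hx hy]
  · rw [wdist_comm]
    exact key hy hx

end Walks

/-- A greedy net on a line: every point `s` is within `f s` of the net, while the sum of `f` over
the net is controlled by the extent of the points. -/
lemma exists_greedy_net {α : Type*} [DecidableEq α] (p f : α → ℝ) (hf : ∀ s, 0 ≤ f s) (l : α)
    (T : Finset α) (hT : ∀ s ∈ T, p l ≤ p s) :
    ∃ A ⊆ insert l T, (∀ s ∈ T, ∃ v ∈ A, |p s - p v| ≤ f s) ∧
      ∃ m ∈ insert l T, ∑ v ∈ A, f v ≤ f l + (p m - p l) := by
  suffices ∃ A ⊆ insert l T, (∀ s ∈ T, ∃ v ∈ A, |p s - p v| ≤ f s) ∧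
      ∃ m ∈ A, ∑ v ∈ A, f v ≤ f l + (p m - p l) by
    obtain ⟨A, hA, hcov, m, hm, hsum⟩ := this
    exact ⟨A, hA, hcov, m, hA hm, hsum⟩
  induction T using Finset.induction_on_max_value p with
  | empty => exact ⟨{l}, by simp, by simp, l, by simp, by simp⟩
  | insert s T hs hmax ih =>
    obtain ⟨A, hA, hcov, m, hm, hsum⟩ := ih fun x hx => hT x (Finset.mem_insert_of_mem hx)
    have hms : p m ≤ p s := by
      rcases Finset.mem_insert.1 (hA hm) with rfl | h
      · exact hT s (Finset.mem_insert_self _ _)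
      · exact hmax m h
    by_cases hc : p s - p m ≤ f s
    · refine ⟨A, hA.trans (Finset.insert_subset_insert _ (Finset.subset_insert _ _)), ?_,
        m, hm, hsum⟩
      intro x hx
      rcases Finset.mem_insert.1 hx with rfl | h
      · exact ⟨m, hm, by rwa [abs_of_nonneg (by linarith)]⟩
      · exact hcov x h
    · refine ⟨insert s A, Finset.insert_subset (by simp)
        (hA.trans (Finset.insert_subset_insert _ (Finset.subset_insert _ _))), ?_,
        s, Finset.mem_insert_self _ _, ?_⟩
      · intro x hx
        rcases Finset.mem_insert.1 hx with rfl | h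
        · exact ⟨x, Finset.mem_insert_self _ _, by simpa using hf x⟩
        · obtain ⟨v, hv, h⟩ := hcov x h
          exact ⟨v, Finset.mem_insert_of_mem hv, h⟩
      · have : ∑ v ∈ insert s A, f v ≤ f s + ∑ v ∈ A, f v := by
          by_cases hsA : s ∈ A
          · rw [Finset.insert_eq_of_mem hsA]
            linarith [hf s]
          · rw [Finset.sum_insert hsA]
        linarith

section EdgeSums

variable {α ι : Type*} [DecidableEq α] {w : α → ℝ}

lemma Finset.sum_union_le_of_nonneg {s t : Finset α} (hs : ∀ e ∈ s, 0 ≤ w e) :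
    ∑ e ∈ s ∪ t, w e ≤ ∑ e ∈ s, w e + ∑ e ∈ t, w e := by
  rw [← Finset.sum_union_inter]
  have := Finset.sum_nonneg (s := s ∩ t) fun e he => hs e (Finset.mem_inter.1 he).1
  linarith

lemma Finset.sum_biUnion_le_of_nonneg [DecidableEq ι] (I : Finset ι) {t : ι → Finset α}
    (ht : ∀ i ∈ I, ∀ e ∈ t i, 0 ≤ w e) :
    ∑ e ∈ I.biUnion t, w e ≤ ∑ i ∈ I, ∑ e ∈ t i, w e := by
  induction I using Finset.induction_on with
  | empty => simp
  | insert i I hi ih =>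
    rw [Finset.biUnion_insert, Finset.sum_insert hi]
    have h1 := Finset.sum_union_le_of_nonneg (t := I.biUnion t) (ht i (by simp))
    have h2 := ih fun j hj => ht j (by simp [hj])
    linarith

lemma List.sum_toFinset_le (L : List α) (hL : ∀ e ∈ L, 0 ≤ w e) :
    ∑ e ∈ L.toFinset, w e ≤ (L.map w).sum := by
  induction L with
  | nil => simp
  | cons a L ih =>
    rw [List.toFinset_cons, List.map_cons, List.sum_cons, Finset.insert_eq]
    have h1 := Finset.sum_union_le_of_nonneg (s := {a}) (t := L.toFinset) (w := w)
      (by simpa using hL a (by simp))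
    have h2 := ih fun e he => hL e (by simp [he])
    rw [Finset.sum_singleton] at h1
    linarith

end EdgeSums

/-- A set of vertices of a shortest walk `S` which serves as portals for a vertex `v`: through
them `v` reaches every vertex of `S` almost optimally, and their total distance from `v` is
comparable to the distance from `v` to `S`. -/
lemma exists_portals {V : Type*} [Finite V] [DecidableEq V] {G : SimpleGraph V} {w : Sym2 V → ℝ}
    (hw : ∀ e ∈ G.edgeSet, 0 < w e) (hG : G.Connected) {a b : V} (S : G.Walk a b)
    (hS : walkWeight w S = wdist G w a b) {η : ℝ} (hη : 0 < η) (hη1 : η ≤ 1) (v : V) {D : ℝ}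
    (hD : ∃ y ∈ S.support, D = wdist G w v y) (hmin : ∀ y ∈ S.support, D ≤ wdist G w v y) :
    ∃ A : Finset V, ∑ y ∈ A, wdist G w v y ≤ 11 * η⁻¹ ^ 2 * D ∧
      ∀ t (ht : t ∈ S.support), ∃ y ∈ A, ∃ hy : y ∈ S.support,
        wdist G w v y + |prefixWeight w S y hy - prefixWeight w S t ht|
          ≤ (1 + 2 * η) * wdist G w v t := by
  obtain ⟨y₀, hy₀, rfl⟩ := hD
  set D := wdist G w v y₀ with hDdef
  have hD0 : 0 ≤ D := wdist_nonneg hw _ _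
  set p : V → ℝ := fun x => if hx : x ∈ S.support then prefixWeight w S x hx else 0 with hp
  have hpx : ∀ {x} (hx : x ∈ S.support), prefixWeight w S x hx = p x := by
    intro x hx
    simp [hp, hx]
  have hS' : ∀ x ∈ S.support, ∀ y ∈ S.support, |p x - p y| ≤ wdist G w x y := by
    intro x hx y hy
    rw [← hpx hx, ← hpx hy]
    exact abs_prefixWeight_sub_le_wdist hw hG S hS hx hy
  have hS'' : ∀ x ∈ S.support, ∀ y ∈ S.support, wdist G w x y ≤ |p x - p y| := by
    intro x hx y hy
    obtain ⟨q, -, hq⟩ := exists_walk_along hw S hx hy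
    rw [← hpx hx, ← hpx hy, ← hq]
    exact wdist_le hw q
  set R := 3 * η⁻¹ * D with hR
  have hi1 : 1 ≤ η⁻¹ := (one_le_inv₀ hη).2 hη1
  have hηi : η * η⁻¹ = 1 := mul_inv_cancel₀ hη.ne'
  have hR0 : 0 ≤ R := by positivity
  set B := S.support.toFinset.filter fun y => |p y - p y₀| ≤ R with hB
  have hmemB : ∀ {y}, y ∈ B ↔ y ∈ S.support ∧ |p y - p y₀| ≤ R := by
    intro y
    simp [hB]
  have hy₀B : y₀ ∈ B := hmemB.2 ⟨hy₀, by simpa using hR0⟩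
  obtain ⟨y₁, hy₁, hy₁min⟩ := B.exists_min_image p ⟨y₀, hy₀B⟩
  obtain ⟨A, hA, hcov, m, hm, hsum⟩ := exists_greedy_net p (fun y => η * wdist G w v y)
    (fun s => mul_nonneg hη.le (wdist_nonneg hw _ _)) y₁ B hy₁min
  rw [Finset.insert_eq_of_mem hy₁] at hA hm
  refine ⟨insert y₀ A, ?_, ?_⟩
  · have h1 : ∑ y ∈ insert y₀ A, wdist G w v y ≤ D + ∑ y ∈ A, wdist G w v y := by
      have := Finset.sum_union_le_of_nonneg (s := {y₀}) (t := A) (w := wdist G w v)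
        fun e _ => wdist_nonneg hw _ _
      rwa [Finset.sum_singleton, ← Finset.insert_eq] at this
    rw [← Finset.mul_sum] at hsum
    have h2 := abs_le.1 (hmemB.1 hm).2
    have h3 := (hmemB.1 hy₁).2
    have h4 := hS'' y₁ (hmemB.1 hy₁).1 y₀ hy₀
    have h5 := wdist_triangle hw hG v y₀ y₁
    rw [wdist_comm y₀ y₁] at h5
    have h3' := abs_le.1 h3
    have h6 : ∑ y ∈ A, wdist G w v y ≤ wdist G w v y₁ + η⁻¹ * (2 * R) := by
      have : η⁻¹ * (η * ∑ y ∈ A, wdist G w v y) ≤ η⁻¹ * (η * wdist G w v y₁ + 2 * R) := by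
        gcongr
        linarith
      rw [mul_add, ← mul_assoc, ← mul_assoc, mul_comm η⁻¹ η, hηi, one_mul, one_mul] at this
      exact this
    have h7 : η⁻¹ * (2 * R) = 6 * (η⁻¹ ^ 2 * D) := by rw [hR]; ring
    have h8 : D ≤ η⁻¹ ^ 2 * D := le_mul_of_one_le_left hD0 (one_le_pow₀ hi1)
    have h9 : η⁻¹ * D ≤ η⁻¹ ^ 2 * D := by
      gcongr
      nlinarith
    have h10 : R = 3 * (η⁻¹ * D) := by rw [hR]; ring
    linarith
  · intro t ht
    have hvt := wdist_nonneg (G := G) hw v t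
    by_cases htB : t ∈ B
    · obtain ⟨y, hy, hty⟩ := hcov t htB
      have hyS := (hmemB.1 (hA hy)).1
      refine ⟨y, Finset.mem_insert_of_mem hy, hyS, ?_⟩
      rw [hpx, hpx]
      have h1 := wdist_triangle hw hG v t y
      have h2 := hS'' t ht y hyS
      rw [abs_sub_comm (p y)]
      linarith
    · refine ⟨y₀, Finset.mem_insert_self _ _, hy₀, ?_⟩
      rw [hpx, hpx, abs_sub_comm (p y₀)]
      have h1 : R < |p t - p y₀| := by
        by_contra! h
        exact htB (hmemB.2 ⟨ht, h⟩)
      have h2 := hS' t ht y₀ hy₀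
      have h3 := wdist_triangle hw hG t v y₀
      rw [wdist_comm t v] at h3
      have h4 : η * R = 3 * D := by
        rw [hR, show η * (3 * η⁻¹ * D) = 3 * (η * η⁻¹) * D by ring, hηi]
        ring
      nlinarith

/-- single-pair strip sparsification.  There is a universal constant
`c > 0` such that: for every finite connected edge-weighted graph `G`, every
`ε ∈ (0, 1/2)`, and every two paths `N`, `S` with common endpoints `l`, `r` such that
`S` is a shortest `l`–`r` path and every proper subpath of `N` is `ε`-short
(distances along `N` between pairs of its vertices other than the pair `{l,r}` are at
most `(1+ε)` times the graph distance), there is a subgraph `H` (a set of edges of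
`G`) containing `N` and `S`, of total weight at most `c·ε⁻⁴·(w(N)+w(S))`, such that
any two vertices of `N ∪ S` are joined in `H` by a walk of weight at most `(1+ε)`
times their distance in `G`. -/
theorem strip_sparsification :
    ∃ c : ℝ, 0 < c ∧
      ∀ (V : Type) [Fintype V] [DecidableEq V] (G : SimpleGraph V) (w : Sym2 V → ℝ),
        (∀ e ∈ G.edgeSet, 0 < w e) → G.Connected →
        ∀ ε : ℝ, 0 < ε → ε < 1 / 2 →
        ∀ (l r : V) (N S : G.Walk l r), N.IsPath → S.IsPath →
        walkWeight w S = wdist G w l r →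
        (∀ (x : V) (hx : x ∈ N.support) (y : V) (hy : y ∈ N.support),
          s(x, y) ≠ s(l, r) →
          |prefixWeight w N x hx - prefixWeight w N y hy| ≤ (1 + ε) * wdist G w x y) →
        ∃ H : Set (Sym2 V), H ⊆ G.edgeSet ∧
          (∀ e ∈ N.edges, e ∈ H) ∧ (∀ e ∈ S.edges, e ∈ H) ∧
          setWeight w H ≤ c * ε⁻¹ ^ 4 * (walkWeight w N + walkWeight w S) ∧
          ∀ s t : V, s ∈ N.support ∨ s ∈ S.support → t ∈ N.support ∨ t ∈ S.support →
            ∃ p : G.Walk s t, (∀ e ∈ p.edges, e ∈ H) ∧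
              walkWeight w p ≤ (1 + ε) * wdist G w s t := by
  refine ⟨3000, by norm_num, ?_⟩
  intro V _ _ G w hw hG ε hε hε2 l r N S _ _ hSw hN
  choose P hP using exists_walkWeight_eq_wdist hw hG
  set η := ε / 6 with hη
  have hη0 : 0 < η := by positivity
  have hη1 : η ≤ 1 := by linarith
  have hnear : ∀ v, ∃ y ∈ S.support, ∀ y' ∈ S.support, wdist G w v y ≤ wdist G w v y' := by
    intro v
    obtain ⟨y, hy, h⟩ := S.support.toFinset.exists_min_image (wdist G w v)
      ⟨l, by simp⟩
    exact ⟨y, by simpa using hy, fun y' hy' => h y' (by simpa using hy')⟩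
  choose near hnearS hnear using hnear
  choose B hBsum hB using fun v => exists_portals hw hG S hSw hη0 hη1 v
    ⟨near v, hnearS v, rfl⟩ (hnear v)
  set p : V → ℝ := fun x => if hx : x ∈ N.support then prefixWeight w N x hx else 0 with hp
  have hpx : ∀ {x} (hx : x ∈ N.support), prefixWeight w N x hx = p x := by
    intro x hx
    simp [hp, hx]
  have hpl : p l = 0 := by
    rw [← hpx N.start_mem_support, prefixWeight_start]
  obtain ⟨A, hA, hcov, m, hm, hsum⟩ := exists_greedy_net p (fun v => η * wdist G w v (near v))
    (fun s => mul_nonneg hη0.le (wdist_nonneg hw _ _)) l N.support.toFinset (by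
      intro s hs
      rw [hpl, ← hpx (by simpa using hs)]
      exact prefixWeight_nonneg hw _ _)
  have hins : insert l N.support.toFinset = N.support.toFinset :=
    Finset.insert_eq_of_mem (by simp)
  rw [hins] at hA hm
  have hmN : m ∈ N.support := by simpa using hm
  have hll : wdist G w l (near l) ≤ 0 :=
    (hnear l l S.start_mem_support).trans
      ((wdist_le hw (SimpleGraph.Walk.nil : G.Walk l l)).trans_eq walkWeight_nil)
  have hsumA : η * ∑ v ∈ A, wdist G w v (near v) ≤ walkWeight w N := by
    have h1 := prefixWeight_add_dropUntil (w := w) N hmN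
    have h2 := walkWeight_nonneg hw (N.dropUntil m hmN)
    rw [← Finset.mul_sum, hpl] at hsum
    rw [hpx] at h1
    nlinarith
  set E : Finset (Sym2 V) := A.biUnion fun v => (B v).biUnion fun y => (P v y).edges.toFinset
    with hE
  have hedge : ∀ {a b : V} (q : G.Walk a b), ∀ e ∈ q.edges, 0 ≤ w e :=
    fun q e he => (hw e (q.edges_subset_edgeSet he)).le
  have hEsum : ∑ e ∈ E, w e ≤ 11 * η⁻¹ ^ 3 * walkWeight w N := by
    calc ∑ e ∈ E, w e
        ≤ ∑ v ∈ A, ∑ e ∈ (B v).biUnion fun y => (P v y).edges.toFinset, w e := by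
          refine Finset.sum_biUnion_le_of_nonneg A fun v _ e he => ?_
          obtain ⟨y, -, he⟩ := Finset.mem_biUnion.1 he
          exact hedge _ e (List.mem_toFinset.1 he)
      _ ≤ ∑ v ∈ A, ∑ y ∈ B v, wdist G w v y := by
          refine Finset.sum_le_sum fun v _ => ?_
          refine (Finset.sum_biUnion_le_of_nonneg (B v) fun y _ e he =>
            hedge _ e (List.mem_toFinset.1 he)).trans (Finset.sum_le_sum fun y _ => ?_)
          rw [← hP v y]
          exact List.sum_toFinset_le _ (hedge _)
      _ ≤ ∑ v ∈ A, 11 * η⁻¹ ^ 2 * wdist G w v (near v) :=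
          Finset.sum_le_sum fun v _ => hBsum v
      _ = 11 * η⁻¹ ^ 3 * (η * ∑ v ∈ A, wdist G w v (near v)) := by
          rw [← Finset.mul_sum]
          field_simp
      _ ≤ 11 * η⁻¹ ^ 3 * walkWeight w N := by gcongr
  set H : Finset (Sym2 V) := N.edges.toFinset ∪ (S.edges.toFinset ∪ E) with hH
  have hNH : ∀ e ∈ N.edges, e ∈ (H : Set (Sym2 V)) := fun e he => by simp [hH, he]
  have hSH : ∀ e ∈ S.edges, e ∈ (H : Set (Sym2 V)) := fun e he => by simp [hH, he]
  have hPH : ∀ v ∈ A, ∀ y ∈ B v, ∀ e ∈ (P v y).edges, e ∈ (H : Set (Sym2 V)) := by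
    intro v hv y hy e he
    have : e ∈ E := Finset.mem_biUnion.2 ⟨v, hv, Finset.mem_biUnion.2 ⟨y, hy, by simpa using he⟩⟩
    simp [hH, this]
  have hcross : ∀ s ∈ N.support, ∀ t ∈ S.support, ∃ q : G.Walk s t,
      (∀ e ∈ q.edges, e ∈ (H : Set (Sym2 V))) ∧
        walkWeight w q ≤ (1 + ε) * wdist G w s t := by
    intro s hs t ht
    obtain ⟨v, hv, hsv⟩ := hcov s (by simpa using hs)
    have hvN : v ∈ N.support := by simpa using hA hv
    obtain ⟨y, hy, hyS, hyt⟩ := hB v t ht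
    obtain ⟨q₁, hq₁, hw₁⟩ := exists_walk_along hw N hs hvN
    obtain ⟨q₂, hq₂, hw₂⟩ := exists_walk_along hw S hyS ht
    refine ⟨q₁.append ((P v y).append q₂), ?_, ?_⟩
    · intro e he
      simp only [SimpleGraph.Walk.edges_append, List.mem_append] at he
      rcases he with he | he | he
      · exact hNH e (hq₁ e he)
      · exact hPH v hv y hy e he
      · exact hSH e (hq₂ e he)
    · rw [walkWeight_append, walkWeight_append, hP, hw₂, hw₁, hpx, hpx]
      have h1 : |p s - p v| ≤ η * wdist G w s t :=
        hsv.trans (mul_le_mul_of_nonneg_left (hnear s t ht) hη0.le)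
      have h2 : wdist G w v s ≤ |p s - p v| := by
        rw [wdist_comm, ← hpx hs, ← hpx hvN, ← hw₁]
        exact wdist_le hw _
      have h3 := wdist_triangle hw hG v s t
      have h4 : wdist G w v t ≤ (1 + η) * wdist G w s t := by linarith
      have h5 : (1 + 2 * η) * wdist G w v t ≤ (1 + 2 * η) * ((1 + η) * wdist G w s t) := by
        gcongr
      have h6 : 0 ≤ wdist G w s t := wdist_nonneg hw _ _
      have h7 : η * (1 - η) * wdist G w s t ≥ 0 := by
        have : 0 ≤ 1 - η := by linarith
        positivity
      have h8 : ε = 6 * η := by rw [hη]; ring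
      rw [h8]
      nlinarith
  refine ⟨H, ?_, hNH, hSH, ?_, ?_⟩
  · intro e he
    simp only [hH, hE, Finset.coe_union, Set.mem_union, Finset.mem_coe, List.mem_toFinset,
      Finset.mem_biUnion] at he
    rcases he with he | he | ⟨v, -, y, -, he⟩
    · exact N.edges_subset_edgeSet he
    · exact S.edges_subset_edgeSet he
    · exact (P v y).edges_subset_edgeSet he
  · rw [setWeight, finsum_mem_coe_finset]
    have h1 := Finset.sum_union_le_of_nonneg (s := N.edges.toFinset) (t := S.edges.toFinset ∪ E)
      fun e he => hedge N e (List.mem_toFinset.1 he)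
    have h2 := Finset.sum_union_le_of_nonneg (s := S.edges.toFinset) (t := E)
      fun e he => hedge S e (List.mem_toFinset.1 he)
    have h3 : ∑ e ∈ N.edges.toFinset, w e ≤ walkWeight w N := List.sum_toFinset_le _ (hedge N)
    have h4 : ∑ e ∈ S.edges.toFinset, w e ≤ walkWeight w S := List.sum_toFinset_le _ (hedge S)
    have hN0 := walkWeight_nonneg hw N
    have hS0 := walkWeight_nonneg hw S
    have hi1 : 1 ≤ ε⁻¹ := (one_le_inv₀ hε).2 (by linarith)
    have h5 : η⁻¹ ^ 3 = 216 * ε⁻¹ ^ 3 := by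
      rw [hη]
      field_simp
      norm_num
    have h6 : ε⁻¹ ^ 3 * walkWeight w N ≤ ε⁻¹ ^ 4 * walkWeight w N := by
      gcongr ?_ * _
      exact pow_le_pow_right₀ hi1 (by norm_num)
    have h7 : walkWeight w N ≤ ε⁻¹ ^ 4 * walkWeight w N :=
      le_mul_of_one_le_left hN0 (one_le_pow₀ hi1)
    have h8 : walkWeight w S ≤ ε⁻¹ ^ 4 * walkWeight w S :=
      le_mul_of_one_le_left hS0 (one_le_pow₀ hi1)
    rw [h5] at hEsum
    linarith
  · have hSS : ∀ s ∈ S.support, ∀ t ∈ S.support, ∃ q : G.Walk s t,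
        (∀ e ∈ q.edges, e ∈ (H : Set (Sym2 V))) ∧
          walkWeight w q ≤ (1 + ε) * wdist G w s t := by
      intro s hs t ht
      obtain ⟨q, hq, hqw⟩ := exists_walk_along hw S hs ht
      refine ⟨q, fun e he => hSH e (hq e he), ?_⟩
      rw [hqw]
      exact (abs_prefixWeight_sub_le_wdist hw hG S hSw hs ht).trans
        (le_mul_of_one_le_left (wdist_nonneg hw _ _) (by linarith))
    rintro s t (hs | hs) (ht | ht)
    · by_cases hst : s(s, t) = s(l, r)
      · rcases Sym2.eq_iff.1 hst with ⟨rfl, rfl⟩ | ⟨rfl, rfl⟩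
        · exact hSS _ S.start_mem_support _ S.end_mem_support
        · exact hSS _ S.end_mem_support _ S.start_mem_support
      · obtain ⟨q, hq, hqw⟩ := exists_walk_along hw N hs ht
        exact ⟨q, fun e he => hNH e (hq e he), hqw.trans_le (hN s hs t ht hst)⟩
    · exact hcross s hs t ht
    · obtain ⟨q, hq, hqw⟩ := hcross t ht s hs
      refine ⟨q.reverse, fun e he => hq e (by simpa using he), ?_⟩
      rwa [walkWeight_reverse, wdist_comm]
    · exact hSS s hs t ht
end

section
/- Let T be a finite tree with positive real edge weights that has at most four leaves (vertices of degree 1). Then the total weight of T is at most twice its weighted diameter: w(T) ≤ 2·max_{u,v ∈ V(T)} w(T[u,v]), where T[u,v] denotes the unique path in T between u and v. -/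
namespace SimpleGraph

variable {V : Type*} {G : SimpleGraph V}

/-- In an acyclic graph, deleting an edge of a path disconnects the endpoints of the path. -/
theorem IsAcyclic.not_reachable_deleteEdges_of_mem_edges (hG : G.IsAcyclic) {u v : V}
    {p : G.Walk u v} (hp : p.IsPath) {e : Sym2 V} (he : e ∈ p.edges) :
    ¬ (G.deleteEdges {e}).Reachable u v := by
  intro h
  obtain ⟨q, hq⟩ := h.exists_isPath
  have hqG : (q.mapLe (G.deleteEdges_le {e})).IsPath := (Walk.isPath_mapLe _).2 hq
  have hpq : p = q.mapLe (G.deleteEdges_le {e}) :=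
    Subtype.mk.inj <| (hG.subsingleton_path u v).elim ⟨p, hp⟩ ⟨_, hqG⟩
  rw [hpq, Walk.edges_mapLe_eq_edges] at he
  simpa using q.edges_subset_edgeSet he

/-- Deleting an edge of a finite acyclic graph separates two of its leaves. -/
theorem IsAcyclic.exists_degree_eq_one_not_reachable_deleteEdges [Fintype V] [DecidableRel G.Adj]
    (hG : G.IsAcyclic) {e : Sym2 V} (he : e ∈ G.edgeSet) :
    ∃ u v, G.degree u = 1 ∧ G.degree v = 1 ∧ ¬ (G.deleteEdges {e}).Reachable u v := by
  let s := {n | ∃ (u v : V) (p : G.Walk u v), p.IsPath ∧ e ∈ p.edges ∧ p.length = n}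
  have hfin : s.Finite := (Set.finite_le_nat (Fintype.card V)).subset
    fun n ⟨_, _, _, hp, _, hn⟩ ↦ hn ▸ hp.length_lt.le
  have hne : s.Nonempty := by
    induction e with
    | h x y =>
      have hxy : G.Adj x y := he
      exact ⟨_, x, y, hxy.toWalk, by simp [hxy.ne], by simp, rfl⟩
  obtain ⟨_, ⟨u, v, p, hp, hep, rfl⟩, hmax⟩ := hfin.exists_maximal hne
  have hlen : ∀ (u' v' : V) (q : G.Walk u' v'), q.IsPath → e ∈ q.edges →
      q.length ≤ p.length := fun u' v' q hq heq ↦ by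
    have := hmax ⟨u', v', q, hq, heq, rfl⟩
    lia
  have hnil : ¬ p.Nil := by
    intro h
    simp [Walk.edges_eq_nil.2 h] at hep
  refine ⟨u, v, ?_, ?_, hG.not_reachable_deleteEdges_of_mem_edges hp hep⟩ <;>
    rw [degree_eq_one_iff_existsUnique_adj]
  · refine ⟨_, p.adj_snd hnil, fun w hadj ↦ hG.eq_snd_of_adj_start hp hadj ?_⟩
    by_contra hw
    have := hlen _ _ (p.cons hadj.symm) (hp.cons hw) (by simp [hep])
    simp at this
  · refine ⟨_, (p.adj_penultimate hnil).symm,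
      fun w hadj ↦ hG.eq_penultimate_of_adj_end hp hadj ?_⟩
    by_contra hw
    have := hlen _ _ (p.concat hadj) (hp.concat hw hadj) (by simp [Walk.edges_concat, hep])
    simp at this

/-- If deleting `e` preserves the connections of `a` to `b` and of `c` to `d` while deleting `f`
destroys both, then `a` and `c` remain connected when `e` is deleted. -/
theorem reachable_deleteEdges_of_separated {e f : Sym2 V} {a b c d : V}
    (hab : (G.deleteEdges {e}).Reachable a b) (hcd : (G.deleteEdges {e}).Reachable c d)
    (hab' : ¬ (G.deleteEdges {f}).Reachable a b) (hcd' : ¬ (G.deleteEdges {f}).Reachable c d) :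
    (G.deleteEdges {e}).Reachable a c := by
  classical
  obtain ⟨p⟩ := hab
  obtain ⟨q⟩ := hcd
  have hp := (p.mapLe (G.deleteEdges_le {e})).mem_edges_of_not_reachable_deleteEdges hab'
  have hq := (q.mapLe (G.deleteEdges_le {e})).mem_edges_of_not_reachable_deleteEdges hcd'
  rw [Walk.edges_mapLe_eq_edges] at hp hq
  induction f with
  | h x y =>
    exact (p.takeUntil x (p.fst_mem_support_of_mem_edges hp)).reachable.trans
      (q.takeUntil x (q.fst_mem_support_of_mem_edges hq)).reachable.symm

end SimpleGraph

theorem Finset.exists_subset_insert_four {α : Type*} [DecidableEq α] [Nonempty α] (s : Finset α)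
    (hs : s.card ≤ 4) : ∃ a b c d : α, s ⊆ {a, b, c, d} := by
  obtain ⟨x⟩ := ‹Nonempty α›
  rw [← Finset.length_toList] at hs
  have key : ∀ l : List α, l.length ≤ 4 →
      ∃ a b c d : α, ∀ y ∈ l, y = a ∨ y = b ∨ y = c ∨ y = d := by
    intro l hl
    match l, hl with
    | [], _ => exact ⟨x, x, x, x, by simp⟩
    | [a], _ => exact ⟨a, a, a, a, by simp⟩
    | [a, b], _ => exact ⟨a, b, b, b, by simp⟩
    | [a, b, c], _ => exact ⟨a, b, c, c, by simp⟩
    | [a, b, c, d], _ => exact ⟨a, b, c, d, by simp⟩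
    | _ :: _ :: _ :: _ :: _ :: _, hl =>
      simp only [List.length_cons] at hl
      omega
  obtain ⟨a, b, c, d, h⟩ := key _ hs
  exact ⟨a, b, c, d, fun y hy ↦ by simpa using h y (by simpa using hy)⟩

/-- If two paths cover all edges, one of them has at least half of the total weight. -/
theorem exists_isPath_sum_le_two_mul_walkWeight {V : Type*} [Fintype V] [DecidableEq V]
    {G : SimpleGraph V} [DecidableRel G.Adj] {w : Sym2 V → ℝ} (hw : ∀ e ∈ G.edgeSet, 0 ≤ w e)
    {a b c d : V} {p : G.Walk a b} {q : G.Walk c d} (hp : p.IsPath) (hq : q.IsPath)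
    (hcover : ∀ e ∈ G.edgeSet, e ∈ p.edges ∨ e ∈ q.edges) :
    ∃ (u v : V) (r : G.Walk u v), r.IsPath ∧
      ∑ e ∈ G.edgeFinset, w e ≤ 2 * walkWeight w r := by
  have hweight : ∀ {u v : V} {r : G.Walk u v}, r.IsPath →
      walkWeight w r = ∑ e ∈ r.edges.toFinset, w e :=
    fun hr ↦ (List.sum_toFinset w hr.isTrail.edges_nodup).symm
  have hsum : ∑ e ∈ G.edgeFinset, w e ≤ walkWeight w p + walkWeight w q := by
    rw [hweight hp, hweight hq, ← Finset.sum_union_inter]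
    have hsub : G.edgeFinset = p.edges.toFinset ∪ q.edges.toFinset := by
      ext e
      simp only [SimpleGraph.mem_edgeFinset, Finset.mem_union, List.mem_toFinset]
      exact ⟨hcover e, fun h ↦ h.elim (fun h ↦ p.edges_subset_edgeSet h)
        (fun h ↦ q.edges_subset_edgeSet h)⟩
    rw [hsub]
    refine le_add_of_nonneg_right (Finset.sum_nonneg fun e he ↦ hw e ?_)
    exact p.edges_subset_edgeSet (List.mem_toFinset.1 (Finset.mem_inter.1 he).1)
  rcases le_total (walkWeight w p) (walkWeight w q) with h | h
  · exact ⟨c, d, q, hq, by linarith⟩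
  · exact ⟨a, b, p, hp, by linarith⟩

/-- A finite tree `T` with positive edge weights and at most four
leaves has total weight at most twice its weighted diameter, i.e. there are vertices
`u, v` such that the total weight of `T` is at most `2·w(T[u,v])`, where `T[u,v]` is
the unique path in `T` between `u` and `v`. -/
theorem tree_four_leaves_weight_le_two_diameter {V : Type*} [Fintype V] [DecidableEq V]
    (T : SimpleGraph V) [DecidableRel T.Adj] (hT : T.IsTree)
    (w : Sym2 V → ℝ) (hw : ∀ e ∈ T.edgeSet, 0 < w e)
    (hleaves : (Finset.univ.filter fun v : V => T.degree v = 1).card ≤ 4) :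
    ∃ (u v : V) (p : T.Walk u v), p.IsPath ∧
      ∑ e ∈ T.edgeFinset, w e ≤ 2 * walkWeight w p := by
  have := hT.connected.nonempty
  obtain ⟨a, b, c, d, hL⟩ := Finset.exists_subset_insert_four _ hleaves
  have hsep : ∀ e ∈ T.edgeSet, ∃ u v, (u = a ∨ u = b ∨ u = c ∨ u = d) ∧
      (v = a ∨ v = b ∨ v = c ∨ v = d) ∧ ¬ (T.deleteEdges {e}).Reachable u v := by
    intro e he
    obtain ⟨u, v, hu, hv, huv⟩ := hT.isAcyclic.exists_degree_eq_one_not_reachable_deleteEdges he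
    exact ⟨u, v, by simpa using hL (Finset.mem_filter.2 ⟨Finset.mem_univ u, hu⟩),
      by simpa using hL (Finset.mem_filter.2 ⟨Finset.mem_univ v, hv⟩), huv⟩
  have hsplit : ∀ e ∈ T.edgeSet, ∀ x y z t : V,
      (∀ u, u = a ∨ u = b ∨ u = c ∨ u = d → u = x ∨ u = y ∨ u = z ∨ u = t) →
      (T.deleteEdges {e}).Reachable x y → (T.deleteEdges {e}).Reachable z t →
      ¬ (T.deleteEdges {e}).Reachable x z := by
    intro e he x y z t hmem hxy hzt hxz
    obtain ⟨u, v, hu, hv, huv⟩ := hsep e he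
    have hx : ∀ u, u = x ∨ u = y ∨ u = z ∨ u = t → (T.deleteEdges {e}).Reachable x u := by
      rintro u (rfl | rfl | rfl | rfl)
      exacts [.refl _, hxy, hxz, hxz.trans hzt]
    exact huv ((hx u (hmem u hu)).symm.trans (hx v (hmem v hv)))
  obtain ⟨p, hp⟩ := hT.connected.exists_isPath a b
  obtain ⟨q, hq⟩ := hT.connected.exists_isPath c d
  obtain ⟨p', hp'⟩ := hT.connected.exists_isPath a c
  obtain ⟨q', hq'⟩ := hT.connected.exists_isPath b d
  have hw' : ∀ e ∈ T.edgeSet, 0 ≤ w e := fun e he ↦ (hw e he).le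
  by_cases h : ∀ e ∈ T.edgeSet, e ∈ p.edges ∨ e ∈ q.edges
  · exact exists_isPath_sum_le_two_mul_walkWeight hw' hp hq h
  refine exists_isPath_sum_le_two_mul_walkWeight hw' hp' hq' fun f hf ↦ ?_
  by_contra! hfn
  push Not at h
  obtain ⟨e, he, hep, heq⟩ := h
  have hab : (T.deleteEdges {e}).Reachable a b :=
    not_not.1 fun h ↦ hep (p.mem_edges_of_not_reachable_deleteEdges h)
  have hcd : (T.deleteEdges {e}).Reachable c d :=
    not_not.1 fun h ↦ heq (q.mem_edges_of_not_reachable_deleteEdges h)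
  have hac : (T.deleteEdges {f}).Reachable a c :=
    not_not.1 fun h ↦ hfn.1 (p'.mem_edges_of_not_reachable_deleteEdges h)
  have hbd : (T.deleteEdges {f}).Reachable b d :=
    not_not.1 fun h ↦ hfn.2 (q'.mem_edges_of_not_reachable_deleteEdges h)
  have hab' := hsplit f hf a c b d (by tauto) hac hbd
  exact hsplit e he a b c d (fun _ ↦ id) hab hcd <|
    SimpleGraph.reachable_deleteEdges_of_separated hab hcd hab'
      fun h ↦ hab' (hac.trans (h.trans hbd.symm))
end

section
/- Let R denote the Boolean relation R(f,g,h) := (f = h) ∨ (g = h). Fix natural numbers n and m, and for each j ∈ {1,…,m} fix a clause consisting of three literals a_j, b_j, c_j, where a literal is either a variable x_i, a negated variable ¬x_i (for some i ∈ {1,…,n}), or a Boolean constant 0 or 1. For Boolean values x_i^+, x_i^- (i ∈ {1,…,n}), translate each literal ℓ to ℓ' by sending x_i to x_i^+, ¬x_i to x_i^-, and constants to themselves. Then the 3-CNF formula ⋀_{j=1}^m (a_j ∨ b_j ∨ c_j) is satisfiable by some truth assignment to x_1,…,x_n (with ¬x_i evaluating to the negation of the value of x_i) if and only if there exist Boolean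 values x_i^+, x_i^- (i ∈ {1,…,n}) and y_j^+, y_j^- (j ∈ {1,…,m}) such that for every i both R(x_i^+, x_i^-, 1) and R(x_i^+, x_i^-, 0) hold, and for every j all three of R(a_j', b_j', y_j^+), R(0, c_j', y_j^-), and R(y_j^+, y_j^-, 1) hold. -/
/-- A literal over variables `x_1, …, x_n`: a variable, a negated variable, or a
Boolean constant. -/
inductive Lit (n : ℕ) where
  | pos (i : Fin n)
  | neg (i : Fin n)
  | const (b : Bool)

/-- Evaluation of a literal under a truth assignment `T` to the variables:
`x_i` evaluates to `T i`, `¬x_i` to its negation, and constants to themselves. -/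
def Lit.eval {n : ℕ} (T : Fin n → Bool) : Lit n → Bool
  | .pos i => T i
  | .neg i => !(T i)
  | .const b => b

/-- The translation `ℓ ↦ ℓ'` of a literal: `x_i ↦ x_i⁺`, `¬x_i ↦ x_i⁻`, and
constants are sent to themselves. -/
def Lit.trans {n : ℕ} (xp xm : Fin n → Bool) : Lit n → Bool
  | .pos i => xp i
  | .neg i => xm i
  | .const b => b

/-- The Boolean relation `R(f,g,h) := (f = h) ∨ (g = h)`. -/
def RRel (f g h : Bool) : Prop := f = h ∨ g = h

theorem Lit.trans_not {n : ℕ} (T : Fin n → Bool) (l : Lit n) :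
    l.trans T (fun i => !(T i)) = l.eval T := by
  cases l <;> rfl

theorem RRel.or (f g : Bool) : RRel f g (f || g) := by
  cases f <;> simp [RRel]

theorem RRel.eq_not {f g : Bool} (h₁ : RRel f g true) (h₀ : RRel f g false) : g = !f := by
  cases f <;> cases g <;> simp_all [RRel]

/-- The 3-CNF formula `⋀_j (a_j ∨ b_j ∨ c_j)` is satisfiable iff
there are Boolean values `x_i⁺, x_i⁻` and `y_j⁺, y_j⁻` satisfying the variable
relations `R(x_i⁺, x_i⁻, 1)`, `R(x_i⁺, x_i⁻, 0)` and the clause relations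
`R(a_j', b_j', y_j⁺)`, `R(0, c_j', y_j⁻)`, `R(y_j⁺, y_j⁻, 1)`. -/
theorem threeSat_iff_RSat (n m : ℕ) (a b c : Fin m → Lit n) :
    (∃ T : Fin n → Bool, ∀ j : Fin m,
        (a j).eval T = true ∨ (b j).eval T = true ∨ (c j).eval T = true) ↔
    (∃ (xp xm : Fin n → Bool) (yp ym : Fin m → Bool),
        (∀ i : Fin n, RRel (xp i) (xm i) true ∧ RRel (xp i) (xm i) false) ∧
        (∀ j : Fin m,
          RRel ((a j).trans xp xm) ((b j).trans xp xm) (yp j) ∧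
          RRel false ((c j).trans xp xm) (ym j) ∧
          RRel (yp j) (ym j) true)) := by
  constructor
  · rintro ⟨T, hT⟩
    refine ⟨T, fun i => !(T i), fun j => (a j).eval T || (b j).eval T,
      fun j => (c j).eval T, fun i => ?_, fun j => ?_⟩
    · cases h : T i <;> simp [RRel, h]
    · simp only [Lit.trans_not]
      refine ⟨RRel.or _ _, Or.inr rfl, ?_⟩
      simpa [RRel, or_assoc] using hT j
  · rintro ⟨xp, xm, yp, ym, hx, hy⟩
    obtain rfl : xm = fun i => !(xp i) := funext fun i => (hx i).1.eq_not (hx i).2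
    refine ⟨xp, fun j => ?_⟩
    obtain ⟨hab, hc, hp | hm⟩ := hy j
    · rw [Lit.trans_not, Lit.trans_not, hp] at hab
      exact hab.elim Or.inl fun h => Or.inr (Or.inl h)
    · rw [Lit.trans_not, hm] at hc
      exact Or.inr (Or.inr (hc.resolve_left Bool.false_ne_true))
end
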